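/- Let k be a positive integer and set s = ⌈k/12⌉. Let D' be a 𝒦_{2,s}-free digraph with minimum pseudo-semidegree at least ⌈k/2⌉. Let T be an antidirected tree with k arcs with Δ₂(T) ≥ ⌊k/4⌋ + 3, and let u, v be distinct vertices of T whose total degrees are Δ(T) and Δ₂(T), respectively. If the double broom B_uv(T) embeds in D', then T embeds in D'. -/

import Mathlib

open Finset

section Defs

variable {V W : Type*}

/-- Number of arcs of a digraph given by a Boolean adjacency relation. -/
def arcCount [Fintype V] (A : V → V → Bool) : ℕ :=
  ((univ : Finset (V × V)).filter (fun p => A p.1 p.2)).card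

/-- Out-neighbourhood. -/
def outNbr [Fintype V] (A : V → V → Bool) (a : V) : Finset V :=
  univ.filter (fun v => A a v)

/-- In-neighbourhood. -/
def inNbr [Fintype V] (A : V → V → Bool) (a : V) : Finset V :=
  univ.filter (fun v => A v a)

/-- Neighbourhood with a sign: `true` = out, `false` = in. -/
def nbr [Fintype V] (A : V → V → Bool) (sign : Bool) (a : V) : Finset V :=
  if sign then outNbr A a else inNbr A a

/-- Total degree (out-degree plus in-degree). -/
def totalDeg [Fintype V] (A : V → V → Bool) (a : V) : ℕ :=
  (outNbr A a).card + (inNbr A a).card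

/-- Maximum total degree `Δ`. -/
def maxDeg [Fintype V] (A : V → V → Bool) : ℕ :=
  univ.sup (totalDeg A)

/-- Second largest element `Δ₂` of the multiset of total degrees. -/
def secondMaxDeg [Fintype V] (A : V → V → Bool) : ℕ :=
  (((univ : Finset V).val.map (totalDeg A)).erase (maxDeg A)).sup

/-- Loopless digraph. -/
def Loopless (A : V → V → Bool) : Prop := ∀ v, ¬ A v v

/-- Antidirected digraph: no directed path with two arcs. -/
def Antidirected (A : V → V → Bool) : Prop := ∀ x y z, A x y → A y z → False

/-- The underlying (undirected) simple graph of a digraph. -/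
def underG (A : V → V → Bool) : SimpleGraph V :=
  SimpleGraph.fromRel (fun x y => A x y)

/-- `𝒦_{2,s}`-freeness: no two distinct vertices `a`, `b` together with signs and `s`
distinct vertices (all different from `a` and `b`) lying in both signed neighbourhoods. -/
def K2sFree [Fintype V] [DecidableEq V] (A : V → V → Bool) (s : ℕ) : Prop :=
  ¬ ∃ (a b : V) (sa sb : Bool) (S : Finset V), a ≠ b ∧ S.card = s ∧
      a ∉ S ∧ b ∉ S ∧ S ⊆ nbr A sa a ∩ nbr A sb b

/-- `T` embeds in `A`: there is an injective arc-preserving map. -/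
def Embeds (T : W → W → Bool) (A : V → V → Bool) : Prop :=
  ∃ f : W → V, Function.Injective f ∧ ∀ x y, T x y → A (f x) (f y)

/-- Vertices of positive out-degree. -/
def outVerts [Fintype V] (A : V → V → Bool) : Finset V :=
  univ.filter (fun v => (outNbr A v).card ≠ 0)

/-- Vertices of positive in-degree. -/
def inVerts [Fintype V] (A : V → V → Bool) : Finset V :=
  univ.filter (fun v => (inNbr A v).card ≠ 0)

/-- A caterpillar: a tree with a path such that every vertex is on the path
or adjacent to it. -/
def IsCaterpillarG {X : Type*} (G : SimpleGraph X) : Prop :=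
  G.IsTree ∧ ∃ (x y : X) (P : G.Walk x y), P.IsPath ∧
    ∀ v, v ∈ P.support ∨ ∃ w ∈ P.support, G.Adj v w

/-- Minimum pseudo-semidegree at least `m`: at least one arc, and every
out-degree and in-degree is `0` or at least `m`. -/
def MinPseudoSemidegGe [Fintype V] (A : V → V → Bool) (m : ℕ) : Prop :=
  0 < arcCount A ∧ (∀ v, (outNbr A v).card = 0 ∨ m ≤ (outNbr A v).card) ∧
    (∀ v, (inNbr A v).card = 0 ∨ m ≤ (inNbr A v).card)

/-- `D'` is a subdigraph of `D` with vertex set `S`. -/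
def SubdigraphOn (D : V → V → Bool) (S : Finset V) (D' : V → V → Bool) : Prop :=
  ∀ x y, D' x y → D x y ∧ x ∈ S ∧ y ∈ S

/-- The vertex set of the double broom `B_{uv}(T)`: the path joining `u` and `v`
together with all neighbours of `u` and all neighbours of `v`. -/
def broomSet [Fintype W] [DecidableEq W] (T : W → W → Bool) {u v : W}
    (p : (underG T).Walk u v) : Finset W :=
  p.support.toFinset ∪ (outNbr T u ∪ inNbr T u) ∪ (outNbr T v ∪ inNbr T v)

/-- `z` lies strictly after `x` and strictly before `y` in clockwise (cyclic) order
on `Fin n`. -/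
def cycBetween {n : ℕ} (x y z : Fin n) : Prop :=
  if x < y then x < z ∧ z < y else x < z ∨ z < y

/-- An arc `pq` of the convex digraph `A` on `Fin n` is good for the antidirected
caterpillar `T` with final vertex `u`, its spine neighbour `v`, and spine with
`plen` edges (so `plen + 1` spine vertices). -/
def GoodArc {n : ℕ} (A : Fin n → Fin n → Bool) (T : W → W → Bool)
    (u v : W) (plen : ℕ) (pq : Fin n × Fin n) : Prop :=
  ∃ f : W → Fin n, Function.Injective f ∧ (∀ x y, T x y → A (f x) (f y)) ∧
    ((T v u = true ∧ (f v, f u) = pq) ∨ (T u v = true ∧ (f u, f v) = pq)) ∧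
    (∀ z : Fin n,
      (plen % 2 = 0 → cycBetween (f u) (f v) z → z ∉ Set.range f) ∧
      (plen % 2 = 1 → z ≠ f u → z ≠ f v → ¬ cycBetween (f u) (f v) z →
        z ∉ Set.range f))

/-- Number of edges of a bipartite graph with parts `α`, `β`. -/
def bipArcCount {α β : Type*} [Fintype α] [Fintype β] (E : α → β → Bool) : ℕ :=
  ((univ : Finset (α × β)).filter (fun p => E p.1 p.2)).card

/-- Degree of a vertex of the `α` part. -/
def bipDegA {α β : Type*} [Fintype β] (E : α → β → Bool) (a : α) : ℕ :=
  (univ.filter (fun b => E a b)).card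

/-- Degree of a vertex of the `β` part. -/
def bipDegB {α β : Type*} [Fintype α] (E : α → β → Bool) (b : β) : ℕ :=
  (univ.filter (fun a => E a b)).card

end Defs

namespace SimpleGraph

variable {W V : Type*} {G : SimpleGraph W}

/-- In an acyclic graph, a vertex outside a connected set has at most one neighbour in the set. -/
lemma IsAcyclic.eq_of_adj_of_connected_induce (hG : G.IsAcyclic) {S : Set W}
    (hS : (G.induce S).Connected) {x x' y : W} (hx : x ∈ S) (hx' : x' ∈ S) (hy : y ∉ S)
    (h : G.Adj x y) (h' : G.Adj x' y) : x = x' := by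
  by_contra hne
  obtain ⟨q, hq⟩ := hS.exists_isPath ⟨x, hx⟩ ⟨x', hx'⟩
  let r : G.Path x x' := ⟨Walk.cons h (Walk.cons h'.symm Walk.nil), by
    simp [h.ne, h'.ne', hne]⟩
  let q' : G.Path x x' := ⟨q.map (Embedding.induce S).toHom,
    hq.map (Embedding.induce (G := G) S).injective⟩
  have hrq : r = q' := (hG.subsingleton_path x x').elim r q'
  have hyr : y ∈ (r : G.Walk x x').support := by simp [r]
  rw [hrq] at hyr
  change y ∈ (q.map (Embedding.induce S).toHom).support at hyr
  rw [Walk.support_map, List.mem_map] at hyr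
  obtain ⟨z, -, rfl⟩ := hyr
  exact hy z.2

lemma connected_induce_insert {S : Set W} (hS : (G.induce S).Connected) {x y : W}
    (hx : x ∈ S) (h : G.Adj x y) : (G.induce (insert y S)).Connected := by
  rw [Set.insert_eq]
  exact connected_induce_union (v := y) (w := x) (by simp) hS.preconnected
    (by simp) hx h.symm

/-- Adding vertices adjacent to a connected set keeps it connected. -/
lemma connected_induce_of_subset_of_adj {A B : Set W} (hA : (G.induce A).Connected) (hAB : A ⊆ B)
    (h : ∀ y ∈ B, y ∈ A ∨ ∃ x ∈ A, G.Adj x y) : (G.induce B).Connected := by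
  obtain ⟨u, hu⟩ := hA.nonempty
  refine induce_connected_of_patches u (hAB hu) fun {y} hy => ?_
  rcases h y hy with hyA | ⟨x, hx, hxy⟩
  · exact ⟨A, hAB, hu, hyA, hA.preconnected _ _⟩
  · exact ⟨insert y A, Set.insert_subset hy hAB, Set.mem_insert_of_mem _ hu, Set.mem_insert _ _,
      (connected_induce_insert hA hx hxy).preconnected _ _⟩

lemma degree_induce_finset [DecidableRel G.Adj] (S : Finset W) (w : S) :
    (G.induce (S : Set W)).degree w = #{y ∈ S | G.Adj w y} := by
  rw [← card_neighborFinset_eq_degree, ← card_map (Function.Embedding.subtype _)]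
  congr 1
  ext y
  simp [and_comm]

lemma sum_card_adj_of_isTree_induce [DecidableRel G.Adj] {S : Finset W}
    (hS : (G.induce (S : Set W)).IsTree) :
    ∑ w ∈ S, #{y ∈ S | G.Adj w y} + 2 = 2 * #S := by
  have h1 := hS.card_edgeFinset
  have h2 := (G.induce (S : Set W)).sum_degrees_eq_twice_card_edges
  have h3 : ∑ w ∈ S, #{y ∈ S | G.Adj w y} = ∑ w : S, (G.induce (S : Set W)).degree w := by
    rw [← sum_coe_sort]
    exact sum_congr rfl fun w _ => (degree_induce_finset S w).symm
  have h4 : Fintype.card (S : Set W) = #S := by simp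
  have h5 : ∑ w : S, (G.induce (S : Set W)).degree w =
    ∑ w : (S : Set W), (G.induce (S : Set W)).degree w := rfl
  omega

lemma card_adj_pos_of_connected_induce [DecidableRel G.Adj] {S : Finset W}
    (hS : (G.induce (S : Set W)).Connected)
    {u v : W} (hu : u ∈ S) (hv : v ∈ S) (huv : u ≠ v) {w : W} (hw : w ∈ S) :
    0 < #{y ∈ S | G.Adj w y} := by
  have : Nontrivial (S : Set W) := ⟨⟨u, hu⟩, ⟨v, hv⟩, by simpa using huv⟩
  have := hS.preconnected.degree_pos_of_nontrivial ⟨w, hw⟩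
  rwa [degree_induce_finset S ⟨w, hw⟩] at this

/-- `f` embeds the subgraph of `G` induced on `S`, where `M x a` is the set of admissible images of
the neighbours of `x` once `x` is mapped to `a`. -/
def IsEmbOn (G : SimpleGraph W) (M : W → V → Finset V) (S : Finset W) (f : W → V) : Prop :=
  Set.InjOn f S ∧ ∀ x ∈ S, ∀ y ∈ S, G.Adj x y → f y ∈ M x (f x)

lemma IsEmbOn.mono {M : W → V → Finset V} {S S' : Finset W} {f : W → V}
    (hf : G.IsEmbOn M S f) (h : S' ⊆ S) : G.IsEmbOn M S' f :=
  ⟨hf.1.mono (by exact_mod_cast h), fun x hx y hy => hf.2 x (h hx) y (h hy)⟩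

variable [DecidableEq W]

/-- A new vertex `y` with a single neighbour `x` in `S` may be mapped to any unused admissible
vertex `z`. -/
lemma IsEmbOn.insert {M : W → V → Finset V}
    (hM : ∀ x y a b, G.Adj x y → b ∈ M x a → a ∈ M y b)
    {S : Finset W} {f : W → V} (hf : G.IsEmbOn M S f) {x y : W} {z : V} (hxS : x ∈ S)
    (hy : y ∉ S) (huniq : ∀ x' ∈ S, G.Adj x' y → x' = x) (hz : ∀ w ∈ S, f w ≠ z)
    (hzM : z ∈ M x (f x)) : G.IsEmbOn M (insert y S) (Function.update f y z) := by
  have hne : ∀ w ∈ S, w ≠ y := by rintro w hw rfl; exact hy hw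
  refine ⟨?_, ?_⟩
  · intro w hw w' hw' h
    simp only [coe_insert, Set.mem_insert_iff, mem_coe] at hw hw'
    rcases hw with rfl | hw <;> rcases hw' with rfl | hw'
    · rfl
    · rw [Function.update_self, Function.update_of_ne (hne _ hw')] at h
      exact absurd h.symm (hz _ hw')
    · rw [Function.update_self, Function.update_of_ne (hne _ hw)] at h
      exact absurd h (hz _ hw)
    · rw [Function.update_of_ne (hne _ hw), Function.update_of_ne (hne _ hw')] at h
      exact hf.1 hw hw' h
  · intro w hw w' hw' h
    rw [mem_insert] at hw hw'
    rcases hw with rfl | hw <;> rcases hw' with rfl | hw'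
    · exact absurd h G.irrefl
    · rw [Function.update_self, Function.update_of_ne (hne _ hw')]
      obtain rfl := huniq w' hw' h.symm
      exact hM _ _ _ _ h.symm hzM
    · rw [Function.update_self, Function.update_of_ne (hne _ hw)]
      obtain rfl := huniq w hw h
      exact hzM
    · rw [Function.update_of_ne (hne _ hw), Function.update_of_ne (hne _ hw')]
      exact hf.2 _ hw _ hw' h

variable [DecidableRel G.Adj]

/-- The leaves of the subtree on `S` that are not adjacent to `x`, together with `x`, are at least
as many as the degrees of two further vertices `u`, `v` force. -/
lemma le_card_insert_leaves {S : Finset W} (hS : (G.induce (S : Set W)).IsTree)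
    {u v x : W} (hu : u ∈ S) (hv : v ∈ S) (hx : x ∈ S) (huv : u ≠ v) (hxu : x ≠ u) (hxv : x ≠ v)
    (hdu : 3 ≤ #{y ∈ S | G.Adj u y}) (hdv : 3 ≤ #{y ∈ S | G.Adj v y}) :
    #{y ∈ S | G.Adj u y} + #{y ∈ S | G.Adj v y} ≤
      #(insert x {w ∈ S | #{y ∈ S | G.Adj w y} = 1 ∧ ¬ G.Adj x w}) + 3 := by
  set d : W → ℕ := fun w => #{y ∈ S | G.Adj w y}
  have hpos : ∀ w ∈ S, 0 < d w := fun w hw =>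
    card_adj_pos_of_connected_induce hS.connected hu hv huv hw
  have hsum : ∑ w ∈ S, d w + 2 = 2 * #S := sum_card_adj_of_isTree_induce hS
  have hleaf : ∑ w ∈ S, (if d w = 1 then 1 else 0) = #{w ∈ S | d w = 1} := by
    rw [card_filter]
  have hsplit : ∀ F : W → ℕ,
      ∑ w ∈ S, F w = ∑ w ∈ S \ {u, v, x}, F w + (F u + (F v + F x)) := by
    intro F
    rw [← sum_sdiff (s₁ := {u, v, x}) (s₂ := S)
      (by simp [insert_subset_iff, hu, hv, hx])]
    rw [sum_insert (by simp [huv, hxu.symm]), sum_insert (by simp [hxv.symm]), sum_singleton]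
  have hrest : 2 * #(S \ {u, v, x}) ≤
      ∑ w ∈ S \ {u, v, x}, (d w + if d w = 1 then 1 else 0) := by
    rw [mul_comm, ← smul_eq_mul, ← sum_const]
    refine sum_le_sum fun w hw => ?_
    have := hpos w (mem_sdiff.1 hw).1
    split_ifs <;> omega
  have hcard : #S = #(S \ {u, v, x}) + 3 := by
    have := hsplit fun _ => 1
    simpa using this
  have htot := hsplit fun w => d w + if d w = 1 then 1 else 0
  rw [sum_add_distrib, hleaf] at htot
  have hcover : #{w ∈ S | d w = 1} ≤ #{w ∈ S | d w = 1 ∧ ¬ G.Adj x w} + d x := by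
    refine (card_le_card fun w hw => ?_).trans (card_union_le _ {y ∈ S | G.Adj x y})
    simp only [mem_union, mem_filter] at hw ⊢
    tauto
  change 3 ≤ d u at hdu
  change 3 ≤ d v at hdv
  change d u + d v ≤ #(insert x {w ∈ S | d w = 1 ∧ ¬ G.Adj x w}) + 3
  have hxpos := hpos x hx
  by_cases hx1 : d x = 1
  · rw [insert_eq_of_mem (by simp [hx, hx1])]
    simp only [hx1] at htot
    split_ifs at htot <;> omega
  · rw [card_insert_of_notMem (by simp [hx1])]
    split_ifs at htot <;> omega

/-- If all admissible neighbours of the image of `x` are used, then every other vertex still has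
an unused one. -/
lemma exists_unused_of_subset_image [DecidableEq V] {M : W → V → Finset V} {c h : ℕ}
    (hc : ∀ x y a b, a ≠ b → #(M x a ∩ M y b) ≤ c)
    {S : Finset W} {f : W → V} (hf : G.IsEmbOn M S f) {u v x q : W} (hu : u ∈ S) (hv : v ∈ S)
    (hx : x ∈ S) (hq : q ∈ S) (huv : u ≠ v) (hxu : x ≠ u) (hxv : x ≠ v) (hqx : q ≠ x)
    (hdu : 3 * c < #{y ∈ S | G.Adj u y}) (hdv : 3 * c < #{y ∈ S | G.Adj v y})
    (hS : #S ≤ 2 * h) (hxh : h ≤ #(M x (f x))) (hqh : h ≤ #(M q (f q)))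
    (hfull : M x (f x) ⊆ S.image f) : ∃ z ∈ M q (f q), ∀ w ∈ S, f w ≠ z := by
  by_contra! hcon
  have hfull' : M q (f q) ⊆ S.image f := fun z hz => by
    obtain ⟨w, hw, h⟩ := hcon z hz
    exact mem_image.2 ⟨w, hw, h⟩
  obtain ⟨r, hr, hrq, hrx, hdr⟩ : ∃ r ∈ S, r ≠ q ∧ r ≠ x ∧ 3 * c < #{y ∈ S | G.Adj r y} := by
    by_cases h : u = q
    · exact ⟨v, hv, h ▸ huv.symm, hxv.symm, hdv⟩
    · exact ⟨u, hu, h, hxu.symm, hdu⟩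
  have hne : ∀ {w w'}, w ∈ S → w' ∈ S → w ≠ w' → f w ≠ f w' :=
    fun hw hw' h h' => h (hf.1 hw hw' h')
  set A := ({y ∈ S | G.Adj r y}).image f with hA
  have hAcard : #A = #{y ∈ S | G.Adj r y} :=
    card_image_of_injOn (hf.1.mono fun _ h => (mem_filter.1 h).1)
  have hAS : A ⊆ S.image f := image_subset_image (filter_subset _ _)
  have hAM : A ⊆ M r (f r) := by
    intro z hz
    simp only [hA, mem_image, mem_filter] at hz
    obtain ⟨w, ⟨hw, hrw⟩, rfl⟩ := hz
    exact hf.2 r hr w hw hrw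
  have hAX : #(A ∩ M x (f x)) ≤ c :=
    (card_le_card (inter_subset_inter_right hAM)).trans (hc _ _ _ _ (hne hr hx hrx))
  have hAQ : #(A ∩ M q (f q)) ≤ c :=
    (card_le_card (inter_subset_inter_right hAM)).trans (hc _ _ _ _ (hne hr hq hrq))
  have hXQ := hc x q _ _ (hne hx hq hqx.symm)
  have hun := card_union_add_card_inter (M x (f x)) (M q (f q))
  have hrest := card_sdiff_add_card_eq_card (union_subset hfull hfull')
  have himg : #(S.image f) ≤ #S := card_image_le
  have hAle : #A ≤ #(A ∩ M x (f x)) + #(A ∩ M q (f q)) +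
      #(S.image f \ (M x (f x) ∪ M q (f q))) := by
    refine (card_le_card (t := (A ∩ M x (f x) ∪ A ∩ M q (f q)) ∪
      (S.image f \ (M x (f x) ∪ M q (f q)))) fun z hz => ?_).trans
      ((card_union_le _ _).trans (Nat.add_le_add_right (card_union_le _ _) _))
    have := hAS hz
    simp only [mem_union, mem_inter, mem_sdiff]
    tauto
  omega

/-- One extension step, possibly after moving a leaf of the embedded part. -/
lemma IsTree.exists_isEmbOn_insert [Fintype W] [DecidableEq V] {M : W → V → Finset V}
    {c h : ℕ} (hG : G.IsTree) (hM : ∀ x y a b, G.Adj x y → b ∈ M x a → a ∈ M y b)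
    (hself : ∀ x a, a ∉ M x a) (hc : ∀ x y a b, a ≠ b → #(M x a ∩ M y b) ≤ c)
    (hh : ∀ x a, (M x a).Nonempty → h ≤ #(M x a)) (hW : Fintype.card W ≤ 2 * h + 1)
    {S : Finset W} {f : W → V} (hS : (G.induce (S : Set W)).Connected)
    (hf : G.IsEmbOn M S f) {u v : W} (huv : u ≠ v) (hu : u ∈ S) (hv : v ∈ S)
    (hNu : ∀ y, G.Adj u y → y ∈ S) (hNv : ∀ y, G.Adj v y → y ∈ S)
    (hcu : 3 * c < G.degree u) (hcv : 3 * c < G.degree v) (hu3 : 3 ≤ G.degree u)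
    (hv3 : 3 ≤ G.degree v) (huvW : Fintype.card W + 2 < h + G.degree u + G.degree v)
    (hSne : S ≠ univ) :
    ∃ y ∉ S, ∃ g : W → V, (G.induce ((insert y S : Finset W) : Set W)).Connected ∧
      G.IsEmbOn M (insert y S) g := by
  have hdeg : ∀ w, (∀ y, G.Adj w y → y ∈ S) → #{y ∈ S | G.Adj w y} = G.degree w := by
    intro w hw
    rw [← card_neighborFinset_eq_degree]
    congr 1
    ext y
    simpa using hw y
  have hdu := hdeg u hNu
  have hdv := hdeg v hNv
  have hcard : #S < Fintype.card W := (card_lt_iff_ne_univ S).2 hSne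
  obtain ⟨y₀, hy₀⟩ : ∃ y, y ∉ S := by
    by_contra! hall
    exact hSne (eq_univ_iff_forall.2 hall)
  obtain ⟨p⟩ := hG.connected.preconnected u y₀
  obtain ⟨⟨⟨x, y⟩, hxy⟩, -, hx, hy⟩ := p.exists_boundary_dart (S : Set W) hu hy₀
  simp only [mem_coe] at hx hy hxy
  have hxu : x ≠ u := by rintro rfl; exact hy (hNu _ hxy)
  have hxv : x ≠ v := by rintro rfl; exact hy (hNv _ hxy)
  have huniq : ∀ x' ∈ S, G.Adj x' y → x' = x := fun x' hx' h' =>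
    hG.isAcyclic.eq_of_adj_of_connected_induce hS (by exact_mod_cast hx') hx hy h' hxy
  refine ⟨y, hy, ?_⟩
  rw [exists_and_left]
  refine ⟨by rw [coe_insert]; exact connected_induce_insert hS hx hxy, ?_⟩
  by_cases hfree : ∃ z ∈ M x (f x), ∀ w ∈ S, f w ≠ z
  · obtain ⟨z, hz, hz'⟩ := hfree
    exact ⟨_, hf.insert hM hx hy huniq hz' hz⟩
  have hfull : M x (f x) ⊆ S.image f := by
    push Not at hfree
    exact fun z hz => mem_image.2 (hfree z hz)
  have hdpos : ∀ w ∈ S, ∃ w' ∈ S, G.Adj w w' := by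
    intro w hw
    obtain ⟨w', hw'⟩ := card_pos.1 (card_adj_pos_of_connected_induce hS hu hv huv hw)
    exact ⟨w', (mem_filter.1 hw').1, (mem_filter.1 hw').2⟩
  have hbig : ∀ w ∈ S, h ≤ #(M w (f w)) := by
    intro w hw
    obtain ⟨w', hw', hadj⟩ := hdpos w hw
    exact hh _ _ ⟨_, hf.2 w hw w' hw' hadj⟩
  set L : Finset W := insert x {w ∈ S | #{y ∈ S | G.Adj w y} = 1 ∧ ¬ G.Adj x w}
  have hLS : L ⊆ S := insert_subset hx (filter_subset _ _)
  have hL : #{y ∈ S | G.Adj u y} + #{y ∈ S | G.Adj v y} ≤ #L + 3 :=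
    le_card_insert_leaves ⟨hS, hG.isAcyclic.induce _⟩ hu hv hx huv hxu hxv
    (by omega) (by omega)
  obtain ⟨w, hwL, hw⟩ : ∃ w ∈ L, f w ∈ M x (f x) := by
    by_contra! hcon
    have hsub : M x (f x) ⊆ (S \ L).image f := by
      intro z hz
      obtain ⟨w, hw, rfl⟩ := mem_image.1 (hfull hz)
      exact mem_image_of_mem _ (mem_sdiff.2 ⟨hw, fun hwL => hcon w hwL hz⟩)
    have h1 := (card_le_card hsub).trans card_image_le
    have h2 := card_sdiff_add_card_eq_card hLS
    have h3 := hbig x hx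
    omega
  have hwx : w ≠ x := by rintro rfl; exact hself _ _ hw
  obtain ⟨hwS, hw1, hxw⟩ : w ∈ S ∧ #{y ∈ S | G.Adj w y} = 1 ∧ ¬ G.Adj x w := by
    simpa [L, hwx] using hwL
  obtain ⟨q, hqeq⟩ := card_eq_one.1 hw1
  have hqmem : q ∈ S ∧ G.Adj w q := by
    rw [← mem_filter (p := fun y => G.Adj w y), hqeq]
    exact mem_singleton_self q
  obtain ⟨hq, hwq⟩ := hqmem
  have hqx : q ≠ x := by rintro rfl; exact hxw hwq.symm
  obtain ⟨z, hz, hz'⟩ := exists_unused_of_subset_image hc hf hu hv hx hq huv hxu hxv hqx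
    (by omega) (by omega) (by omega) (hbig x hx) (hbig q hq) hfull
  have hmove : G.IsEmbOn M S (Function.update f w z) := by
    have := (hf.mono (erase_subset w S)).insert hM (x := q) (mem_erase.2 ⟨hwq.ne', hq⟩)
      (notMem_erase w S) (fun x' hx' h' => ?_) (fun w' hw' => hz' w' (mem_of_mem_erase hw')) hz
    · rwa [insert_erase hwS] at this
    · have : x' ∈ ({y ∈ S | G.Adj w y} : Finset W) :=
        mem_filter.2 ⟨mem_of_mem_erase hx', h'.symm⟩
      rwa [hqeq, mem_singleton] at this
  refine ⟨_, hmove.insert hM (z := f w) hx hy huniq (fun w' hw' => ?_) ?_⟩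
  · by_cases hww : w' = w
    · rw [hww, Function.update_self]
      exact (hz' w hwS).symm
    · rw [Function.update_of_ne hww]
      exact fun h' => hww (hf.1 hw' hwS h')
  · rwa [Function.update_of_ne hwx.symm]

/-- An embedding of a connected part containing `u`, `v` and all their neighbours extends to the
whole tree. -/
lemma IsTree.exists_isEmbOn_univ [Fintype W] [DecidableEq V] {M : W → V → Finset V}
    {c h : ℕ} (hG : G.IsTree) (hM : ∀ x y a b, G.Adj x y → b ∈ M x a → a ∈ M y b)
    (hself : ∀ x a, a ∉ M x a) (hc : ∀ x y a b, a ≠ b → #(M x a ∩ M y b) ≤ c)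
    (hh : ∀ x a, (M x a).Nonempty → h ≤ #(M x a)) (hW : Fintype.card W ≤ 2 * h + 1)
    {S : Finset W} {f : W → V} (hS : (G.induce (S : Set W)).Connected)
    (hf : G.IsEmbOn M S f) {u v : W} (huv : u ≠ v) (hu : u ∈ S) (hv : v ∈ S)
    (hNu : ∀ y, G.Adj u y → y ∈ S) (hNv : ∀ y, G.Adj v y → y ∈ S)
    (hcu : 3 * c < G.degree u) (hcv : 3 * c < G.degree v) (hu3 : 3 ≤ G.degree u)
    (hv3 : 3 ≤ G.degree v) (huvW : Fintype.card W + 2 < h + G.degree u + G.degree v) :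
    ∃ g : W → V, G.IsEmbOn M univ g := by
  by_cases hSuniv : S = univ
  · exact ⟨f, hSuniv ▸ hf⟩
  obtain ⟨y, hy, g, hconn, hg⟩ := hG.exists_isEmbOn_insert hM hself hc hh hW hS hf huv hu hv hNu
    hNv hcu hcv hu3 hv3 huvW hSuniv
  have : #(Sᶜ.erase y) < #Sᶜ := card_erase_lt_of_mem (mem_compl.2 hy)
  exact hG.exists_isEmbOn_univ hM hself hc hh hW hconn hg huv (mem_insert_of_mem hu)
    (mem_insert_of_mem hv) (fun w hw => mem_insert_of_mem (hNu w hw))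
    (fun w hw => mem_insert_of_mem (hNv w hw)) hcu hcv hu3 hv3 huvW
termination_by #Sᶜ

end SimpleGraph

section AntidirectedTree

variable {V W : Type*}

lemma Antidirected.underG_adj {T : W → W → Bool} (hT : Antidirected T) {x y : W} :
    (underG T).Adj x y ↔ T x y ∨ T y x := by
  rw [underG, SimpleGraph.fromRel_adj, and_iff_right_iff_imp]
  rintro (h | h) rfl <;> exact hT _ _ _ h h

lemma Antidirected.degree_underG [Fintype W] {T : W → W → Bool} (hT : Antidirected T)
    [DecidableRel (underG T).Adj] (x : W) : (underG T).degree x = totalDeg T x := by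
  classical
  rw [totalDeg, ← card_union_of_disjoint, ← SimpleGraph.card_neighborFinset_eq_degree]
  · congr 1
    ext y
    simp [outNbr, inNbr, hT.underG_adj]
  · rw [disjoint_left]
    intro y hy hy'
    simp only [outNbr, inNbr, mem_filter, mem_univ, true_and] at hy hy'
    exact hT _ _ _ hy hy'

lemma sum_totalDeg [Fintype W] (T : W → W → Bool) : ∑ x, totalDeg T x = 2 * arcCount T := by
  have h1 : ∑ x, (outNbr T x).card = arcCount T := by
    simp only [outNbr, arcCount, card_filter, ← univ_product_univ, sum_product]
  have h2 : ∑ x, (inNbr T x).card = arcCount T := by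
    simp only [inNbr, arcCount, card_filter, ← univ_product_univ, sum_product_right]
  simp only [totalDeg, sum_add_distrib, h1, h2]
  ring

lemma Antidirected.card_eq_arcCount_add_one [Fintype W] {T : W → W → Bool} (hT : Antidirected T)
    (htree : (underG T).IsTree) : Fintype.card W = arcCount T + 1 := by
  classical
  have h1 := htree.card_edgeFinset
  have h2 := (underG T).sum_degrees_eq_twice_card_edges
  simp only [hT.degree_underG, sum_totalDeg] at h2
  omega

lemma mem_nbr [Fintype V] {A : V → V → Bool} {sign : Bool} {a b : V} :
    b ∈ nbr A sign a ↔ if sign then A a b else A b a := by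
  cases sign <;> simp [nbr, outNbr, inNbr]

open Classical in
/-- The sign of a non-isolated vertex: `true` for out-vertices, `false` for in-vertices. -/
noncomputable def vertSign (T : W → W → Bool) (x : W) : Bool :=
  decide (∃ y, T x y)

lemma vertSign_of_arc {T : W → W → Bool} {x y : W} (h : T x y) : vertSign T x = true := by
  simpa [vertSign] using ⟨y, h⟩

lemma Antidirected.vertSign_of_arc {T : W → W → Bool} (hT : Antidirected T) {x y : W}
    (h : T x y) : vertSign T y = false := by
  simpa [vertSign] using fun z hz => hT _ _ _ h hz

lemma K2sFree.card_inter_lt [Fintype V] [DecidableEq V] {A : V → V → Bool} {s : ℕ}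
    (hA : K2sFree A s) (hloop : Loopless A) {a b : V} (hab : a ≠ b) (sa sb : Bool) :
    (nbr A sa a ∩ nbr A sb b).card < s := by
  by_contra! h
  have hself : ∀ c (sc : Bool), c ∉ nbr A sc c := by
    intro c sc hc
    rw [mem_nbr, ite_self] at hc
    exact hloop c hc
  obtain ⟨S, hS, hcard⟩ := exists_subset_card_eq h
  exact hA ⟨a, b, sa, sb, S, hab, hcard, fun ha => hself a sa (mem_inter.1 (hS ha)).1,
    fun hb => hself b sb (mem_inter.1 (hS hb)).2, hS⟩

lemma MinPseudoSemidegGe.le_card_nbr [Fintype V] {A : V → V → Bool} {m : ℕ}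
    (hA : MinPseudoSemidegGe A m) {sign : Bool} {a : V} (h : (nbr A sign a).Nonempty) :
    m ≤ (nbr A sign a).card := by
  have hne := h.card_pos.ne'
  cases sign
  · exact (hA.2.2 a).resolve_left hne
  · exact (hA.2.1 a).resolve_left hne

lemma Antidirected.isEmbOn_iff [Fintype V] {T : W → W → Bool} (hT : Antidirected T)
    {A : V → V → Bool} {S : Finset W} {f : W → V} :
    (underG T).IsEmbOn (fun x a => nbr A (vertSign T x) a) S f ↔
      Set.InjOn f S ∧ ∀ x ∈ S, ∀ y ∈ S, T x y → A (f x) (f y) := by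
  refine and_congr_right fun _ => ⟨fun h x hx y hy hxy => ?_, fun h x hx y hy hxy => ?_⟩
  · have := h x hx y hy (hT.underG_adj.2 (Or.inl hxy))
    rwa [mem_nbr, _root_.vertSign_of_arc hxy, if_pos rfl] at this
  · rw [mem_nbr]
    rcases hT.underG_adj.1 hxy with hxy | hyx
    · rw [_root_.vertSign_of_arc hxy, if_pos rfl]
      exact h x hx y hy hxy
    · rw [hT.vertSign_of_arc hyx, if_neg (by simp)]
      exact h y hy x hx hyx

lemma Antidirected.mem_broomSet [Fintype W] [DecidableEq W] {T : W → W → Bool}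
    (hT : Antidirected T) {u v : W} (p : (underG T).Walk u v) {y : W} :
    y ∈ broomSet T p ↔ y ∈ p.support ∨ (underG T).Adj u y ∨ (underG T).Adj v y := by
  simp [broomSet, outNbr, inNbr, hT.underG_adj, or_assoc]

lemma Antidirected.connected_induce_broomSet [Fintype W] [DecidableEq W] {T : W → W → Bool}
    (hT : Antidirected T) {u v : W} (p : (underG T).Walk u v) :
    ((underG T).induce (broomSet T p : Set W)).Connected := by
  refine SimpleGraph.connected_induce_of_subset_of_adj p.connected_induce_support
    (fun y hy => mem_coe.2 ((hT.mem_broomSet p).2 (Or.inl hy))) fun y hy => ?_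
  rcases (hT.mem_broomSet p).1 (mem_coe.1 hy) with h | h | h
  · exact Or.inl h
  · exact Or.inr ⟨u, p.start_mem_support, h⟩
  · exact Or.inr ⟨v, p.end_mem_support, h⟩

end AntidirectedTree

/-- (Extension step.) If the double broom `B_uv(T)` embeds in the
`𝒦_{2,s}`-free digraph `D'` of minimum pseudo-semidegree at least `⌈k/2⌉`, then the whole
antidirected tree `T` embeds in `D'`. -/
theorem stmt_18 (k : ℕ) (hk : 0 < k)
    {V : Type*} [Fintype V] [DecidableEq V]
    (D' : V → V → Bool) (hloop : Loopless D')
    (hfree : K2sFree D' ((k + 11) / 12))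
    (hmin : MinPseudoSemidegGe D' ((k + 1) / 2))
    {W : Type*} [Fintype W] [DecidableEq W]
    (T : W → W → Bool) (hT : Antidirected T)
    (htree : (underG T).IsTree) (hkT : arcCount T = k)
    (hD2 : k / 4 + 3 ≤ secondMaxDeg T)
    (u v : W) (huv : u ≠ v)
    (hu : totalDeg T u = maxDeg T) (hv : totalDeg T v = secondMaxDeg T)
    (p : (underG T).Walk u v) (hp : p.IsPath)
    (hemb : ∃ f : W → V, Set.InjOn f ↑(broomSet T p) ∧
      ∀ x ∈ broomSet T p, ∀ y ∈ broomSet T p, T x y → D' (f x) (f y)) :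
    Embeds T D' := by
  classical
  obtain ⟨f, hf⟩ := hemb
  set M : W → V → Finset V := fun x a => nbr D' (vertSign T x) a
  have hM : ∀ x y a b, (underG T).Adj x y → b ∈ M x a → a ∈ M y b := by
    intro x y a b hxy
    simp only [M, mem_nbr]
    rcases hT.underG_adj.1 hxy with h | h <;>
      simp [vertSign_of_arc h, hT.vertSign_of_arc h]
  have hself : ∀ x a, a ∉ M x a := by
    intro x a ha
    rw [mem_nbr, ite_self] at ha
    exact hloop a ha
  have hc : ∀ x y a b, a ≠ b → (M x a ∩ M y b).card ≤ (k + 11) / 12 - 1 :=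
    fun x y a b hab => Nat.le_sub_one_of_lt (hfree.card_inter_lt hloop hab _ _)
  have hW := hT.card_eq_arcCount_add_one htree
  have hdu : k / 4 + 3 ≤ (underG T).degree u := by
    have : totalDeg T v ≤ maxDeg T := le_sup (mem_univ v)
    rw [hT.degree_underG]
    omega
  have hdv : k / 4 + 3 ≤ (underG T).degree v := by
    rw [hT.degree_underG]
    omega
  obtain ⟨g, hg⟩ := htree.exists_isEmbOn_univ hM hself hc (fun _ _ h => hmin.le_card_nbr h)
    (by omega) (hT.connected_induce_broomSet p) (hT.isEmbOn_iff.2 hf) huv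
    ((hT.mem_broomSet p).2 (Or.inl p.start_mem_support))
    ((hT.mem_broomSet p).2 (Or.inl p.end_mem_support))
    (fun y hy => (hT.mem_broomSet p).2 (Or.inr (Or.inl hy)))
    (fun y hy => (hT.mem_broomSet p).2 (Or.inr (Or.inr hy)))
    (by omega) (by omega) (by omega) (by omega) (by omega)
  obtain ⟨hinj, harc⟩ := hT.isEmbOn_iff.1 hg
  exact ⟨g, by simpa using hinj, fun x y => harc x (mem_univ x) y (mem_univ y)⟩
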